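/- Let μ be a random vector in ℝ^d whose moments of all orders exist, let ζ be a centered Gaussian random vector in ℝ^d with covariance matrix R independent of μ, and set X = μ + ζ. For any multiset A = {α₁,…,α_{2N+1}} of 2N+1 indices with 1 ≤ α_i ≤ d, E[X_A] = ∑_{k=0}^{N} ∑_{S ⊆ A, |S| = 2k+1} E[μ_S] · ∑_{σ∈Π(A∖S)} ∏_{pairs (i,j) of σ} E[ζ_{α_i} ζ_{α_j}], where the inner sum over S runs over all sub-multisets of A (subsets of the index positions) of odd cardinality 2k+1. -/

import Mathlib

open MeasureTheory ProbabilityTheory Matrix Finset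
open scoped Classical

/-- The centered `d`-variate Gaussian density with covariance matrix `R`:
`φ_R(x) = |2πR|^{-1/2} exp(-½ xᵀ R⁻¹ x)`. -/
noncomputable def gaussianPdf {d : ℕ} (R : Matrix (Fin d) (Fin d) ℝ) (x : Fin d → ℝ) : ℝ :=
  (Real.sqrt ((2 * Real.pi) ^ d * R.det))⁻¹ * Real.exp (-(x ⬝ᵥ (R⁻¹ *ᵥ x)) / 2)

/-- The centered Gaussian measure on `ℝ^d` with (positive definite) covariance matrix `R`. -/
noncomputable def gaussianMeasure {d : ℕ} (R : Matrix (Fin d) (Fin d) ℝ) :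
    Measure (Fin d → ℝ) :=
  volume.withDensity fun x => ENNReal.ofReal (gaussianPdf R x)

/-- Pairings of a finite set `B` of index positions, encoded as fixed-point-free (on `B`)
involutions of `Fin m` that fix the complement of `B` pointwise. -/
noncomputable def pairingsOn {m : ℕ} (B : Finset (Fin m)) : Finset (Equiv.Perm (Fin m)) :=
  Finset.univ.filter fun σ =>
    (∀ i, σ (σ i) = i) ∧ (∀ i ∈ B, σ i ≠ i ∧ σ i ∈ B) ∧ ∀ i ∉ B, σ i = i

/-- The Isserlis pairing sum `∑_{σ∈Π(B)} ∏_{pairs (i,j) of σ} C (α i) (α j)` over the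
set `B` of index positions, where `C i j` stands for the second moment `E[X_i X_j]`. -/
noncomputable def pairSum {d m : ℕ} (C : Fin d → Fin d → ℝ) (α : Fin m → Fin d)
    (B : Finset (Fin m)) : ℝ :=
  ∑ σ ∈ pairingsOn B, ∏ i ∈ B.filter (fun i => i < σ i), C (α i) (α (σ i))

/-- If all powers of finitely many random variables are integrable, so are all powers of their
products. -/
theorem integrable_finset_prod_pow {Ω ι : Type*} [MeasurableSpace Ω] {P : Measure Ω}
    [IsFiniteMeasure P] (f : ι → Ω → ℝ) (hm : ∀ i, Measurable (f i))
    (hf : ∀ i (k : ℕ), Integrable (fun ω => f i ω ^ k) P) (S : Finset ι) (k : ℕ) :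
    Integrable (fun ω => (∏ i ∈ S, f i ω) ^ k) P := by
  induction S using Finset.induction_on generalizing k with
  | empty => simp
  | insert a S ha ih =>
    simp only [Finset.prod_insert ha]
    refine ((hf a (k * 2)).add (ih (k * 2))).mono' ?_ (ae_of_all _ fun ω => ?_)
    · exact (((hm a).mul
        (Finset.measurable_prod S fun i _ => hm i)).pow_const k).aestronglyMeasurable
    · simp only [Pi.add_apply, mul_pow, pow_mul, norm_mul, Real.norm_eq_abs]
      rw [← sq_abs (f a ω ^ k), ← sq_abs ((∏ i ∈ S, f i ω) ^ k)]
      nlinarith [sq_nonneg (|f a ω ^ k| - |(∏ i ∈ S, f i ω) ^ k|),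
        sq_nonneg (|f a ω ^ k|), sq_nonneg (|(∏ i ∈ S, f i ω) ^ k|)]

theorem integrable_finset_prod_of_integrable_pow {Ω ι : Type*} [MeasurableSpace Ω] {P : Measure Ω}
    [IsFiniteMeasure P] (f : ι → Ω → ℝ) (hm : ∀ i, Measurable (f i))
    (hf : ∀ i (k : ℕ), Integrable (fun ω => f i ω ^ k) P) (S : Finset ι) :
    Integrable (fun ω => ∏ i ∈ S, f i ω) P := by
  simpa using integrable_finset_prod_pow f hm hf S 1

section gaussian

variable {d : ℕ} {R : Matrix (Fin d) (Fin d) ℝ}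

theorem gaussianPdf_nonneg (R : Matrix (Fin d) (Fin d) ℝ) (x : Fin d → ℝ) :
    0 ≤ gaussianPdf R x := by
  unfold gaussianPdf; positivity

theorem continuous_gaussianPdf (R : Matrix (Fin d) (Fin d) ℝ) : Continuous (gaussianPdf R) := by
  unfold gaussianPdf; fun_prop

theorem integrable_gaussianMeasure_iff {f : (Fin d → ℝ) → ℝ} :
    Integrable f (gaussianMeasure R) ↔ Integrable (fun x => f x * gaussianPdf R x) := by
  unfold gaussianMeasure
  rw [integrable_withDensity_iff (continuous_gaussianPdf R).measurable.ennreal_ofReal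
    (ae_of_all _ fun _ => ENNReal.ofReal_lt_top)]
  simp only [ENNReal.toReal_ofReal (gaussianPdf_nonneg R _)]

theorem integral_gaussianMeasure (f : (Fin d → ℝ) → ℝ) :
    ∫ x, f x ∂gaussianMeasure R = ∫ x, f x * gaussianPdf R x := by
  unfold gaussianMeasure
  rw [integral_withDensity_eq_integral_toReal_smul
    (continuous_gaussianPdf R).measurable.ennreal_ofReal
    (ae_of_all _ fun _ => ENNReal.ofReal_lt_top)]
  simp only [ENNReal.toReal_ofReal (gaussianPdf_nonneg R _), smul_eq_mul, mul_comm]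

theorem dotProduct_inv_mulVec_add_smul_col (hR : R.PosDef) (k : Fin d) (x : Fin d → ℝ) (t : ℝ) :
    (x + t • R.col k) ⬝ᵥ (R⁻¹ *ᵥ (x + t • R.col k)) =
      x ⬝ᵥ (R⁻¹ *ᵥ x) + 2 * t * x k + t ^ 2 * R k k := by
  have hu : IsUnit R.det := hR.det_pos.ne'.isUnit
  have hsymm : Rᵀ = R := by simpa [Matrix.IsHermitian] using hR.isHermitian
  have h1 : R⁻¹ *ᵥ R.col k = Pi.single k 1 := by
    rw [← Matrix.mulVec_single_one, Matrix.mulVec_mulVec, Matrix.nonsing_inv_mul _ hu,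
      Matrix.one_mulVec]
  have h2 : R.col k ⬝ᵥ (R⁻¹ *ᵥ x) = x k := by
    rw [Matrix.dotProduct_mulVec, ← Matrix.mulVec_transpose, Matrix.transpose_nonsing_inv, hsymm,
      h1, single_one_dotProduct]
  rw [Matrix.mulVec_add, Matrix.mulVec_smul, h1]
  simp only [dotProduct_add, add_dotProduct, smul_dotProduct, dotProduct_smul, h2,
    dotProduct_single_one, smul_eq_mul, Pi.add_apply, Pi.smul_apply,
    Matrix.col_apply]
  ring

theorem sq_div_le_dotProduct_inv_mulVec (hR : R.PosDef) (k : Fin d) (x : Fin d → ℝ) :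
    x k ^ 2 / R k k ≤ x ⬝ᵥ (R⁻¹ *ᵥ x) := by
  have hk : 0 < R k k := hR.diag_pos
  have h := hR.inv.posSemidef.dotProduct_mulVec_nonneg (x + (-(x k / R k k)) • R.col k)
  rw [star_trivial, dotProduct_inv_mulVec_add_smul_col hR] at h
  have : 2 * (-(x k / R k k)) * x k + (-(x k / R k k)) ^ 2 * R k k = -(x k ^ 2 / R k k) := by
    field_simp; ring
  linarith

theorem gaussianPdf_le (hR : R.PosDef) (x : Fin d → ℝ) :
    gaussianPdf R x ≤ (Real.sqrt ((2 * Real.pi) ^ d * R.det))⁻¹ *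
      ∏ j, Real.exp (-(2 * d * R j j)⁻¹ * x j ^ 2) := by
  unfold gaussianPdf
  rw [← Real.exp_sum]
  refine mul_le_mul_of_nonneg_left (Real.exp_le_exp.2 ?_) (by positivity)
  rcases Nat.eq_zero_or_pos d with rfl | hd
  · simp
  have hd' : (0 : ℝ) < d := by exact_mod_cast hd
  have h := Finset.sum_le_sum fun j (_ : j ∈ Finset.univ) =>
    sq_div_le_dotProduct_inv_mulVec hR j x
  rw [Finset.sum_const, Finset.card_univ, Fintype.card_fin, nsmul_eq_mul] at h
  have h2 : ∑ j, -(2 * d * R j j)⁻¹ * x j ^ 2 = -(2 * d : ℝ)⁻¹ * ∑ j, x j ^ 2 / R j j := by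
    rw [Finset.mul_sum]
    refine Finset.sum_congr rfl fun j _ => ?_
    rw [mul_inv]; ring
  rw [h2]
  have h3 := mul_le_mul_of_nonneg_left h (by positivity : (0 : ℝ) ≤ (2 * d : ℝ)⁻¹)
  have h4 : (2 * d : ℝ)⁻¹ * (d * (x ⬝ᵥ (R⁻¹ *ᵥ x))) = (x ⬝ᵥ (R⁻¹ *ᵥ x)) / 2 := by
    field_simp
  linarith

theorem integrable_eval_pow_gaussianMeasure (hR : R.PosDef) (i : Fin d) (k : ℕ) :
    Integrable (fun x : Fin d → ℝ => x i ^ k) (gaussianMeasure R) := by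
  rw [integrable_gaussianMeasure_iff]
  have hb : ∀ j, 0 < (2 * d * R j j)⁻¹ := fun j => by
    have : 0 < d := (Nat.zero_le _).trans_lt j.2
    have := hR.diag_pos (i := j)
    positivity
  have hint : Integrable (fun x : Fin d → ℝ =>
      ∏ j, x j ^ (if j = i then k else 0) * Real.exp (-(2 * d * R j j)⁻¹ * x j ^ 2)) := by
    refine Integrable.fintype_prod
      (f := fun j (y : ℝ) => y ^ (if j = i then k else 0) * Real.exp (-(2 * d * R j j)⁻¹ * y ^ 2))
      fun j => ?_
    simpa only [Real.rpow_natCast] using integrable_rpow_mul_exp_neg_mul_sq (hb j)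
      (s := ((if j = i then k else 0 : ℕ) : ℝ))
      (neg_one_lt_zero.trans_le (Nat.cast_nonneg _))
  refine (hint.norm.const_mul (Real.sqrt ((2 * Real.pi) ^ d * R.det))⁻¹).mono' ?_
    (ae_of_all _ fun x => ?_)
  · have := continuous_gaussianPdf R
    exact Continuous.aestronglyMeasurable (by fun_prop)
  · rw [Finset.prod_mul_distrib]
    have h1 : ∏ j, x j ^ (if j = i then k else 0) = x i ^ k := by
      rw [Finset.prod_eq_single i] <;> simp +contextual
    rw [h1, norm_mul, norm_mul, Real.norm_of_nonneg (gaussianPdf_nonneg R x),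
      Real.norm_of_nonneg (Finset.prod_nonneg fun j _ => (Real.exp_pos _).le), mul_left_comm]
    exact mul_le_mul_of_nonneg_left (gaussianPdf_le hR x) (norm_nonneg _)

theorem hasLineDerivAt_gaussianPdf (hR : R.PosDef) (k : Fin d) (x : Fin d → ℝ) :
    HasLineDerivAt ℝ (gaussianPdf R) (-(x k * gaussianPdf R x)) x (R.col k) := by
  unfold HasLineDerivAt gaussianPdf
  simp only [dotProduct_inv_mulVec_add_smul_col hR]
  have h : HasDerivAt (fun t : ℝ => -(x ⬝ᵥ (R⁻¹ *ᵥ x) + 2 * t * x k + t ^ 2 * R k k) / 2)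
      (-x k) 0 := by
    have h2 := ((((hasDerivAt_id (0 : ℝ)).const_mul 2).mul_const (x k)).const_add
      (x ⬝ᵥ (R⁻¹ *ᵥ x))).add (((hasDerivAt_id (0 : ℝ)).pow 2).mul_const (R k k))
    convert! (h2.neg.div_const 2) using 1
    simp only [id_eq, mul_one, Nat.cast_ofNat, Nat.add_one_sub_one, pow_one, mul_zero, zero_mul,
      add_zero]
    ring
  convert! (h.exp.const_mul (Real.sqrt ((2 * Real.pi) ^ d * R.det))⁻¹) using 1
  simp
  ring

theorem hasLineDerivAt_finset_prod_eval {ι : Type*} [DecidableEq ι] (α : ι → Fin d) (T : Finset ι)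
    (x v : Fin d → ℝ) :
    HasLineDerivAt ℝ (fun x : Fin d → ℝ => ∏ i ∈ T, x (α i))
      (∑ j ∈ T, v (α j) * ∏ i ∈ T.erase j, x (α i)) x v := by
  unfold HasLineDerivAt
  have h := HasDerivAt.fun_finsetProd (u := T) (x := (0 : ℝ))
    (f := fun i t => (x + t • v) (α i)) (f' := fun i => v (α i)) fun i _ => by
      simpa using ((hasDerivAt_id (0 : ℝ)).mul_const (v (α i))).const_add (x (α i))
  simpa [mul_comm] using h

variable [IsProbabilityMeasure (gaussianMeasure R)]

theorem integrable_prod_eval_gaussianMeasure (hR : R.PosDef) {ι : Type*} (α : ι → Fin d)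
    (T : Finset ι) : Integrable (fun x : Fin d → ℝ => ∏ i ∈ T, x (α i)) (gaussianMeasure R) :=
  integrable_finset_prod_of_integrable_pow (fun i (x : Fin d → ℝ) => x (α i))
    (fun _ => measurable_pi_apply _)
    (fun i k => integrable_eval_pow_gaussianMeasure hR (α i) k) T

/-- Stein's identity for monomials under the centered Gaussian measure. -/
theorem integral_eval_mul_prod_gaussianMeasure (hR : R.PosDef) {ι : Type*} [DecidableEq ι]
    (α : ι → Fin d) (k : Fin d) (T : Finset ι) :
    ∫ x, x k * ∏ i ∈ T, x (α i) ∂gaussianMeasure R =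
      ∑ j ∈ T, R (α j) k * ∫ x, ∏ i ∈ T.erase j, x (α i) ∂gaussianMeasure R := by
  have hsum : ∀ j ∈ T, Integrable (fun x => R (α j) k * ∏ i ∈ T.erase j, x (α i))
      (gaussianMeasure R) := fun j _ =>
    (integrable_prod_eval_gaussianMeasure hR α _).const_mul _
  have hk : Integrable (fun x : Fin d → ℝ => x k * ∏ i ∈ T, x (α i)) (gaussianMeasure R) := by
    simpa [Finset.prod_insertNone] using integrable_prod_eval_gaussianMeasure hR
      (fun i : Option ι => i.elim k α) (Finset.insertNone T)
  have h := integral_bilinear_hasLineDerivAt_right_eq_neg_left_of_integrable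
    (μ := (volume : Measure (Fin d → ℝ))) (B := ContinuousLinearMap.mul ℝ ℝ)
    (f := fun x => ∏ i ∈ T, x (α i)) (g := gaussianPdf R) (v := R.col k)
    (f' := fun x => ∑ j ∈ T, R.col k (α j) * ∏ i ∈ T.erase j, x (α i))
    (g' := fun x => -(x k * gaussianPdf R x))
    (integrable_gaussianMeasure_iff.1 (integrable_finsetSum T hsum))
    (by
      refine (integrable_gaussianMeasure_iff.1 hk).neg.congr (ae_of_all _ fun x => ?_)
      simp only [Pi.neg_apply, ContinuousLinearMap.mul_apply']
      ring)
    (integrable_gaussianMeasure_iff.1 (integrable_prod_eval_gaussianMeasure hR α T))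
    (fun x _ => hasLineDerivAt_finset_prod_eval α T x _)
    (fun x _ => hasLineDerivAt_gaussianPdf hR k x)
  simp only [ContinuousLinearMap.mul_apply', mul_neg, integral_neg, neg_inj] at h
  calc ∫ x, x k * ∏ i ∈ T, x (α i) ∂gaussianMeasure R
      = ∫ x, (∏ i ∈ T, x (α i)) * (x k * gaussianPdf R x) := by
        rw [integral_gaussianMeasure]
        refine integral_congr_ae (ae_of_all _ fun x => ?_)
        simp only
        ring
    _ = ∫ x, (∑ j ∈ T, R (α j) k * ∏ i ∈ T.erase j, x (α i)) ∂gaussianMeasure R := by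
        rw [h, integral_gaussianMeasure]
        rfl
    _ = _ := by
        rw [integral_finsetSum T hsum]
        simp only [integral_const_mul]

theorem integral_eval_mul_eval_gaussianMeasure (hR : R.PosDef) (k l : Fin d) :
    ∫ x, x k * x l ∂gaussianMeasure R = R l k := by
  simpa using integral_eval_mul_prod_gaussianMeasure hR (fun _ : Unit => l) k Finset.univ

end gaussian

section pairings

variable {m : ℕ}

theorem mem_pairingsOn {B : Finset (Fin m)} {σ : Equiv.Perm (Fin m)} :
    σ ∈ pairingsOn B ↔
      (∀ i, σ (σ i) = i) ∧ (∀ i ∈ B, σ i ≠ i ∧ σ i ∈ B) ∧ ∀ i ∉ B, σ i = i := by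
  simp [pairingsOn]

theorem swap_mul_apply_of_ne {σ : Equiv.Perm (Fin m)} (h : ∀ i, σ (σ i) = i) {a i : Fin m}
    (hia : i ≠ a) (hi : i ≠ σ a) : (Equiv.swap a (σ a) * σ) i = σ i := by
  rw [Equiv.Perm.mul_apply, Equiv.swap_apply_of_ne_of_ne]
  · intro h'
    exact hi (by rw [← h', h])
  · exact fun h' => hia (σ.injective h')

theorem pairSum_empty {d : ℕ} (C : Fin d → Fin d → ℝ) (α : Fin m → Fin d) :
    pairSum C α ∅ = 1 := by
  have h : pairingsOn (∅ : Finset (Fin m)) = {1} := by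
    ext σ
    rw [mem_pairingsOn, Finset.mem_singleton]
    constructor
    · rintro ⟨-, -, h⟩
      ext i
      simp [h i]
    · rintro rfl
      simp
  simp [pairSum, h]

theorem swap_mul_mem_pairingsOn_erase {B : Finset (Fin m)} {σ : Equiv.Perm (Fin m)}
    (hσ : σ ∈ pairingsOn B) (a : Fin m) :
    Equiv.swap a (σ a) * σ ∈ pairingsOn ((B.erase a).erase (σ a)) := by
  obtain ⟨h1, h2, h3⟩ := mem_pairingsOn.1 hσ
  have key : ∀ i, i ≠ a → i ≠ σ a → (Equiv.swap a (σ a) * σ) i = σ i := fun i =>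
    swap_mul_apply_of_ne h1
  have ka : (Equiv.swap a (σ a) * σ) a = a := by simp
  have kb : (Equiv.swap a (σ a) * σ) (σ a) = σ a := by simp [h1]
  rw [mem_pairingsOn]
  refine ⟨fun i => ?_, fun i hi => ?_, fun i hi => ?_⟩
  · by_cases hi : i = a
    · rw [hi, ka, ka]
    by_cases hi' : i = σ a
    · rw [hi', kb, kb]
    rw [key i hi hi', key, h1]
    · intro h
      exact hi' (by rw [← h, h1])
    · exact fun h => hi (σ.injective h)
  · simp only [Finset.mem_erase] at hi ⊢
    rw [key i hi.2.1 hi.1]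
    refine ⟨(h2 i hi.2.2).1, fun h => hi.2.1 (σ.injective h), fun h => hi.1 ?_, (h2 i hi.2.2).2⟩
    rw [← h, h1]
  · by_cases hia : i = a
    · rw [hia, ka]
    by_cases hi' : i = σ a
    · rw [hi', kb]
    rw [key i hia hi']
    refine h3 i fun hB => hi ?_
    simp [hia, hi', hB]

theorem swap_mul_mem_pairingsOn {B : Finset (Fin m)} {a j : Fin m} (ha : a ∈ B)
    (hj : j ∈ B.erase a) {τ : Equiv.Perm (Fin m)} (hτ : τ ∈ pairingsOn ((B.erase a).erase j)) :
    (Equiv.swap a j * τ) a = j ∧ Equiv.swap a j * τ ∈ pairingsOn B := by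
  obtain ⟨h1, h2, h3⟩ := mem_pairingsOn.1 hτ
  obtain ⟨hja, hjB⟩ := Finset.mem_erase.1 hj
  have ta : τ a = a := h3 a (by simp)
  have tj : τ j = j := h3 j (by simp)
  have key : ∀ i, i ≠ a → i ≠ j → (Equiv.swap a j * τ) i = τ i := fun i hi hi' => by
    rw [Equiv.Perm.mul_apply, Equiv.swap_apply_of_ne_of_ne]
    · exact fun h => hi (τ.injective (h.trans ta.symm))
    · exact fun h => hi' (τ.injective (h.trans tj.symm))
  have ka : (Equiv.swap a j * τ) a = j := by simp [ta]
  have kj : (Equiv.swap a j * τ) j = a := by simp [tj]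
  refine ⟨ka, mem_pairingsOn.2 ⟨fun i => ?_, fun i hi => ?_, fun i hi => ?_⟩⟩
  · by_cases hi : i = a
    · rw [hi, ka, kj]
    by_cases hi' : i = j
    · rw [hi', kj, ka]
    rw [key i hi hi', key, h1]
    · exact fun h => hi (τ.injective (h.trans ta.symm))
    · exact fun h => hi' (τ.injective (h.trans tj.symm))
  · by_cases hia : i = a
    · rw [hia, ka]
      exact ⟨hja, hjB⟩
    by_cases hi' : i = j
    · rw [hi', kj]
      exact ⟨hja.symm, ha⟩
    rw [key i hia hi']
    have := h2 i (by simp [hia, hi', hi])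
    simp only [Finset.mem_erase] at this
    exact ⟨this.1, this.2.2.2⟩
  · rw [key i (fun h => hi (h ▸ ha)) (fun h => hi (h ▸ hjB))]
    exact h3 i (by simp [hi])

theorem prod_filter_lt_pairing_eq {M : Type*} [CommMonoid M] (f : Fin m → Fin m → M)
    {B : Finset (Fin m)} {a : Fin m} (ha : a ∈ B) (hmin : ∀ i ∈ B, a ≤ i)
    {σ : Equiv.Perm (Fin m)} (hσ : σ ∈ pairingsOn B) :
    ∏ i ∈ B.filter (fun i => i < σ i), f i (σ i) =
      f a (σ a) * ∏ i ∈ ((B.erase a).erase (σ a)).filter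
        (fun i => i < (Equiv.swap a (σ a) * σ) i), f i ((Equiv.swap a (σ a) * σ) i) := by
  obtain ⟨h1, h2, h3⟩ := mem_pairingsOn.1 hσ
  have key : ∀ i, i ≠ a → i ≠ σ a → (Equiv.swap a (σ a) * σ) i = σ i := fun i =>
    swap_mul_apply_of_ne h1
  have hlt : a < σ a := lt_of_le_of_ne (hmin _ (h2 a ha).2) (h2 a ha).1.symm
  rw [← Finset.mul_prod_erase _ _ (Finset.mem_filter.2 ⟨ha, hlt⟩)]
  congr 1
  have hset : (B.filter (fun i => i < σ i)).erase a =
      ((B.erase a).erase (σ a)).filter (fun i => i < (Equiv.swap a (σ a) * σ) i) := by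
    ext i
    simp only [Finset.mem_erase, Finset.mem_filter]
    constructor
    · rintro ⟨hia, hiB, hi⟩
      have hi' : i ≠ σ a := by
        rintro rfl
        rw [h1] at hi
        exact absurd hi hlt.not_gt
      exact ⟨⟨hi', hia, hiB⟩, by rwa [key i hia hi']⟩
    · rintro ⟨⟨hi', hia, hiB⟩, hi⟩
      exact ⟨hia, hiB, by rwa [key i hia hi'] at hi⟩
  rw [hset]
  refine Finset.prod_congr rfl fun i hi => ?_
  simp only [Finset.mem_erase, Finset.mem_filter] at hi
  rw [key i hi.1.2.1 hi.1.1]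

/-- The pairing sum expanded along the partner of the least position. -/
theorem pairSum_eq_sum_erase {d : ℕ} (C : Fin d → Fin d → ℝ) (α : Fin m → Fin d)
    {B : Finset (Fin m)} {a : Fin m} (ha : a ∈ B) (hmin : ∀ i ∈ B, a ≤ i) :
    pairSum C α B =
      ∑ j ∈ B.erase a, C (α a) (α j) * pairSum C α ((B.erase a).erase j) := by
  simp only [pairSum, Finset.mul_sum]
  rw [Finset.sum_sigma']
  refine Finset.sum_bij' (fun σ _ => ⟨σ a, Equiv.swap a (σ a) * σ⟩)
    (fun p _ => Equiv.swap a p.1 * p.2) ?_ ?_ ?_ ?_ ?_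
  · intro σ hσ
    obtain ⟨h1, h2⟩ := (mem_pairingsOn.1 hσ).2.1 a ha
    exact Finset.mem_sigma.2 ⟨Finset.mem_erase.2 ⟨h1, h2⟩, swap_mul_mem_pairingsOn_erase hσ a⟩
  · rintro ⟨j, τ⟩ hp
    obtain ⟨hj, hτ⟩ := Finset.mem_sigma.1 hp
    exact (swap_mul_mem_pairingsOn ha hj hτ).2
  · intro σ _
    exact Equiv.swap_mul_self_mul _ _ _
  · rintro ⟨j, τ⟩ hp
    obtain ⟨hj, hτ⟩ := Finset.mem_sigma.1 hp
    have h := (swap_mul_mem_pairingsOn ha hj hτ).1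
    simp only [h, Equiv.swap_mul_self_mul]
  · intro σ hσ
    exact prod_filter_lt_pairing_eq (fun i j => C (α i) (α j)) ha hmin hσ

theorem pairSum_eq_zero_of_odd_card {d : ℕ} (C : Fin d → Fin d → ℝ) (α : Fin m → Fin d)
    {B : Finset (Fin m)} (hB : Odd B.card) : pairSum C α B = 0 := by
  induction B using Finset.strongInduction with
  | H B ih =>
    have hne : B.Nonempty := Finset.card_pos.1 hB.pos
    rw [pairSum_eq_sum_erase C α (B.min'_mem hne) fun i hi => B.min'_le i hi]
    refine Finset.sum_eq_zero fun j hj => ?_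
    rw [ih _ ((Finset.erase_subset _ _).trans_ssubset (Finset.erase_ssubset (B.min'_mem hne))) ?_,
      mul_zero]
    have h1 := Finset.card_erase_add_one hj
    have h2 := Finset.card_erase_add_one (B.min'_mem hne)
    rw [Nat.odd_iff] at hB ⊢
    omega

end pairings

/-- **Isserlis' theorem** for the centered Gaussian measure. -/
theorem integral_prod_eval_gaussianMeasure {d m : ℕ} {R : Matrix (Fin d) (Fin d) ℝ}
    [IsProbabilityMeasure (gaussianMeasure R)] (hR : R.PosDef) (α : Fin m → Fin d)
    (B : Finset (Fin m)) :
    ∫ x, ∏ i ∈ B, x (α i) ∂gaussianMeasure R =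
      pairSum (fun i j => ∫ x, x i * x j ∂gaussianMeasure R) α B := by
  induction B using Finset.strongInduction with
  | H B ih =>
    rcases B.eq_empty_or_nonempty with rfl | hne
    · simp [pairSum_empty]
    have ha := B.min'_mem hne
    rw [pairSum_eq_sum_erase _ α ha fun i hi => B.min'_le i hi]
    simp only [← Finset.mul_prod_erase B _ ha]
    rw [integral_eval_mul_prod_gaussianMeasure hR]
    refine Finset.sum_congr rfl fun j _ => ?_
    rw [integral_eval_mul_eval_gaussianMeasure hR,
      ih _ ((Finset.erase_subset _ _).trans_ssubset (Finset.erase_ssubset ha))]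

theorem sum_finset_eq_sum_odd_card {N : ℕ} {M : Type*} [AddCommMonoid M]
    (F : Finset (Fin (2 * N + 1)) → M) (hF : ∀ S, ¬ Odd S.card → F S = 0) :
    ∑ S, F S = ∑ k ∈ Finset.range (N + 1),
      ∑ S ∈ Finset.univ.powerset.filter
        (fun S : Finset (Fin (2 * N + 1)) => S.card = 2 * k + 1), F S := by
  rw [← Finset.sum_filter_of_ne (p := fun S => Odd S.card) fun S _ h => not_not.1 (mt (hF S) h),
    ← Finset.sum_fiberwise_of_maps_to (t := Finset.range (N + 1)) (g := fun S => S.card / 2)]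
  · refine Finset.sum_congr rfl fun k _ => Finset.sum_congr ?_ fun _ _ => rfl
    ext S
    simp only [Finset.mem_filter, Finset.mem_univ, true_and, Finset.mem_powerset,
      Finset.subset_univ, Nat.odd_iff]
    omega
  · intro S _
    have := Finset.card_le_univ S
    rw [Fintype.card_fin] at this
    rw [Finset.mem_range]
    omega

/-- **Isserlis theorem for a general Gaussian location mixture (odd case)**: if
`X = μ + ζ` with `μ` a random vector having moments of all orders and `ζ` a centered
Gaussian vector with covariance `R` independent of `μ`, and `A = {α₁,…,α_{2N+1}}`, then
`E[X_A] = ∑_{k=0}^{N} ∑_{S⊆A, |S|=2k+1} E[μ_S] ∑∏_{A∖S} E[ζ_i ζ_j]`. -/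
theorem location_mixture_isserlis_odd {d N : ℕ} {Ω : Type*} [MeasurableSpace Ω]
    (P : Measure Ω) [IsProbabilityMeasure P]
    (R : Matrix (Fin d) (Fin d) ℝ) (hR : R.PosDef)
    (μ : Ω → Fin d → ℝ) (hμm : Measurable μ)
    (hμmom : ∀ (k : ℕ) (i : Fin d), Integrable (fun ω => μ ω i ^ k) P)
    (ζ : Ω → Fin d → ℝ) (hζm : Measurable ζ)
    (hζ : Measure.map ζ P = gaussianMeasure R)
    (hind : IndepFun μ ζ P)
    (X : Ω → Fin d → ℝ) (hX : ∀ ω i, X ω i = μ ω i + ζ ω i)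
    (α : Fin (2 * N + 1) → Fin d) :
    ∫ ω, ∏ i, X ω (α i) ∂P =
      ∑ k ∈ Finset.range (N + 1),
        ∑ S ∈ Finset.univ.powerset.filter
            (fun S : Finset (Fin (2 * N + 1)) => S.card = 2 * k + 1),
          (∫ ω, ∏ i ∈ S, μ ω (α i) ∂P) *
            pairSum (fun i j => ∫ ω, ζ ω i * ζ ω j ∂P) α (Finset.univ \ S) := by
  have hprob : IsProbabilityMeasure (gaussianMeasure R) := by
    rw [← hζ]
    exact Measure.isProbabilityMeasure_map hζm.aemeasurable
  have hC : (fun i j => ∫ ω, ζ ω i * ζ ω j ∂P) =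
      fun i j => ∫ x, x i * x j ∂gaussianMeasure R := by
    ext i j
    rw [← hζ, integral_map hζm.aemeasurable (by fun_prop)]
  have hμi (S : Finset (Fin (2 * N + 1))) : Integrable (fun ω => ∏ i ∈ S, μ ω (α i)) P :=
    integrable_finset_prod_of_integrable_pow (fun i ω => μ ω (α i)) (fun i => by fun_prop)
      (fun i k => hμmom k (α i)) S
  have hζi (S : Finset (Fin (2 * N + 1))) : Integrable (fun ω => ∏ i ∈ S, ζ ω (α i)) P := by
    have h := integrable_prod_eval_gaussianMeasure hR α S
    rw [← hζ] at h
    exact h.comp_measurable hζm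
  have hζint (S : Finset (Fin (2 * N + 1))) : ∫ ω, ∏ i ∈ S, ζ ω (α i) ∂P =
      pairSum (fun i j => ∫ ω, ζ ω i * ζ ω j ∂P) α S := by
    rw [hC, ← integral_prod_eval_gaussianMeasure hR, ← hζ,
      integral_map hζm.aemeasurable
        (Finset.measurable_prod S fun i _ => measurable_pi_apply (α i)).aestronglyMeasurable]
  have hind' (S T : Finset (Fin (2 * N + 1))) :
      IndepFun (fun ω => ∏ i ∈ S, μ ω (α i)) (fun ω => ∏ i ∈ T, ζ ω (α i)) P :=
    hind.comp (φ := fun x : Fin d → ℝ => ∏ i ∈ S, x (α i))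
      (ψ := fun x : Fin d → ℝ => ∏ i ∈ T, x (α i)) (by fun_prop) (by fun_prop)
  rw [← sum_finset_eq_sum_odd_card]
  · simp only [hX, Finset.prod_add, Finset.powerset_univ]
    rw [integral_finsetSum _ fun S _ => by
      exact (hind' S _).integrable_mul (hμi S) (hζi (Finset.univ \ S))]
    refine Finset.sum_congr rfl fun S _ => ?_
    rw [(hind' S _).integral_fun_mul_eq_mul_integral (hμi S).aestronglyMeasurable
      (hζi _).aestronglyMeasurable, hζint]
  · intro S hS
    rw [pairSum_eq_zero_of_odd_card, mul_zero]
    have := Finset.card_sdiff_add_card_eq_card (Finset.subset_univ S)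
    rw [Finset.card_univ, Fintype.card_fin] at this
    rw [Nat.odd_iff] at hS ⊢
    omega
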